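/- Let n, m ≥ 2. The rank of the wreath product PT_n ≀ T_m equals 5: there is a subset of cardinality 5 generating PT_n ≀ T_m as a monoid, and no subset of cardinality at most 4 generates it. -/

import Mathlib

/-- The monoid of partial transformations of `Ω`, encoded as functions
`Ω → Option Ω`; multiplication is left-to-right composition. -/
def PT (Ω : Type) : Type := Ω → Option Ω

instance PT.instOne {Ω : Type} : One (PT Ω) := ⟨fun x => some x⟩

instance PT.instMul {Ω : Type} : Mul (PT Ω) := ⟨fun f g x => (f x).bind g⟩

instance PT.instMonoid {Ω : Type} : Monoid (PT Ω) where
  mul_assoc f g h := by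
    funext x
    show ((f x).bind g).bind h = (f x).bind fun y => (g y).bind h
    cases f x <;> rfl
  one_mul f := rfl
  mul_one f := by
    funext x
    show (f x).bind (fun y => some y) = f x
    cases f x <;> rfl

/-- The empty partial transformation. -/
def PT.empty (Ω : Type) : PT Ω := fun _ => none

/-- A partial transformation of `Fin n × Fin m` preserves the uniform
equivalence `(i,j) E (k,l) ↔ j = l` if images of points in the same class
lie in the same class. -/
def PreservesE (n m : ℕ) (α : PT (Fin n × Fin m)) : Prop :=
  ∀ (i k : Fin n) (j : Fin m) (a c : Fin n) (b d : Fin m),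
    α (i, j) = some (a, b) → α (k, j) = some (c, d) → b = d
/-- The wreath product `PT_n ≀ T_m`: underlying set `(Fin m → PT (Fin n)) × (Fin m → Fin m)`. -/
def W (n m : ℕ) : Type := (Fin m → PT (Fin n)) × (Fin m → Fin m)

instance W.instOne {n m : ℕ} : One (W n m) := ⟨(fun _ => 1, fun j => j)⟩

instance W.instMul {n m : ℕ} : Mul (W n m) :=
  ⟨fun a b => (fun j => a.1 j * b.1 (a.2 j), fun j => b.2 (a.2 j))⟩

instance W.instMonoid {n m : ℕ} : Monoid (W n m) where
  mul_assoc a b c := Prod.ext (funext fun j => mul_assoc _ _ _) rfl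
  one_mul a := rfl
  mul_one a := Prod.ext (funext fun j => mul_one _) rfl

/-- The map `φ : PT_n ≀ T_m → PT_{n×m}`. -/
def phiW (n m : ℕ) (w : W n m) : PT (Fin n × Fin m) :=
  fun p => (w.1 p.2 p.1).map fun i => (i, w.2 p.2)

/-- Constructor for elements of the wreath product. -/
def W.mk {n m : ℕ} (f : Fin m → PT (Fin n)) (τ : Fin m → Fin m) : W n m := (f, τ)

open Equiv

section Group

variable {G : Type*} [Group G] [Finite G]

theorem Submonoid.inv_mem_of_finite (M : Submonoid G) {g : G} (hg : g ∈ M) : g⁻¹ ∈ M := by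
  obtain ⟨k, hk⟩ := mem_powers_iff_mem_zpowers.2 (inv_mem (Subgroup.mem_zpowers g))
  exact hk ▸ pow_mem hg k

theorem Submonoid.mem_of_subgroup_closure_eq_top (M : Submonoid G) {s : Set G}
    (hs : Subgroup.closure s = ⊤) (hM : s ⊆ M) (g : G) : g ∈ M := by
  have h : g ∈ (Subgroup.closure s).toSubmonoid := by simp [hs]
  rw [Subgroup.closure_toSubmonoid_of_finite] at h
  exact Submonoid.closure_le.2 hM h

end Group

/-- Commuting elements of coprime exponents both lie in any submonoid containing their product. -/
theorem Submonoid.mem_and_mem_of_coprime {M : Type*} [Monoid M] (S : Submonoid M) {x y : M}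
    {a b : ℕ} (hxy : Commute x y) (hx : x ^ a = 1) (hy : y ^ b = 1) (hab : a.Coprime b)
    (h : x * y ∈ S) : x ∈ S ∧ y ∈ S := by
  constructor
  · obtain ⟨e, ha, hb⟩ := Nat.chineseRemainder hab 1 0
    have hb' : b ∣ e := (Nat.modEq_zero_iff_dvd).1 hb
    have key : (x * y) ^ e = x := by
      rw [hxy.mul_pow, pow_eq_pow_of_modEq ha hx, pow_one]
      obtain ⟨k, rfl⟩ := hb'
      rw [pow_mul, hy, one_pow, mul_one]
    exact key ▸ pow_mem h e
  · obtain ⟨e, ha, hb⟩ := Nat.chineseRemainder hab 0 1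
    have ha' : a ∣ e := (Nat.modEq_zero_iff_dvd).1 ha
    have key : (x * y) ^ e = y := by
      rw [hxy.mul_pow, pow_eq_pow_of_modEq hb hy, pow_one]
      obtain ⟨k, rfl⟩ := ha'
      rw [pow_mul, hx, one_pow, one_mul]
    exact key ▸ pow_mem h e

theorem finRotate_pow_self (n : ℕ) : finRotate (n + 1) ^ (n + 1) = 1 := by
  cases n with
  | zero => exact Equiv.ext fun _ => Subsingleton.elim (α := Fin 1) _ _
  | succ n =>
    have h : orderOf (finRotate (n + 2)) = n + 2 := by
      rw [isCycle_finRotate.orderOf, support_finRotate, Finset.card_univ, Fintype.card_fin]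
    exact orderOf_dvd_iff_pow_eq_one.1 h.dvd

theorem closure_finRotate_swap (n : ℕ) :
    Subgroup.closure {finRotate (n + 2), swap 0 1} = ⊤ := by
  have h := Perm.closure_cycle_adjacent_swap (isCycle_finRotate (n := n)) support_finRotate 0
  rwa [finRotate_apply, zero_add] at h

/-- The cycle `(1 2 ⋯ n+1)` fixing `0`. -/
def rotateSucc (n : ℕ) : Perm (Fin (n + 2)) := Perm.decomposeFin.symm (0, finRotate (n + 1))

theorem rotateSucc_zero (n : ℕ) : rotateSucc n 0 = 0 := by simp [rotateSucc]

theorem rotateSucc_pow_self (n : ℕ) : rotateSucc n ^ (n + 1) = 1 := by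
  have hs (k : ℕ) (x : Fin (n + 1)) :
      (rotateSucc n ^ k) x.succ = ((finRotate (n + 1) ^ k) x).succ := by
    induction k with
    | zero => rfl
    | succ k ih =>
      rw [pow_succ', Perm.mul_apply, ih, rotateSucc, Perm.decomposeFin_symm_apply_succ, swap_self,
        pow_succ', Perm.mul_apply]
      rfl
  ext x
  refine congrArg Fin.val ?_
  refine Fin.cases ?_ (fun x => ?_) x
  · exact Function.IsFixedPt.perm_pow (rotateSucc_zero n) _
  · rw [hs, finRotate_pow_self]
    rfl

theorem swap_mul_rotateSucc (n : ℕ) : swap 0 1 * rotateSucc n = finRotate (n + 2) := by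
  rw [finRotate_succ_eq_decomposeFin]
  ext x
  refine congrArg Fin.val ?_
  refine Fin.cases ?_ (fun x => ?_) x
  · simp [rotateSucc]
  · simp [rotateSucc]

theorem closure_rotateSucc_swap (n : ℕ) :
    Subgroup.closure {rotateSucc n, swap 0 1} = ⊤ := by
  rw [eq_top_iff, ← closure_finRotate_swap, Subgroup.closure_le]
  have hs : swap 0 1 ∈ Subgroup.closure {rotateSucc n, swap 0 1} :=
    Subgroup.subset_closure (by simp)
  rintro _ (rfl | rfl)
  · rw [← swap_mul_rotateSucc]
    exact mul_mem hs (Subgroup.subset_closure (by simp))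
  · exact hs

/-- `Perm (Fin (n + 2))` is generated by the swap `(0 1)` and a permutation of odd order. -/
theorem exists_odd_pow_eq_one_closure_swap (n : ℕ) :
    ∃ (q : Perm (Fin (n + 2))) (k : ℕ), Odd k ∧ q ^ k = 1 ∧
      Subgroup.closure {q, swap 0 1} = ⊤ := by
  rcases Nat.even_or_odd (n + 2) with h | h
  · exact ⟨rotateSucc n, n + 1, by grind, rotateSucc_pow_self n, closure_rotateSucc_swap n⟩
  · exact ⟨finRotate (n + 2), n + 2, h, finRotate_pow_self (n + 1), closure_finRotate_swap n⟩

theorem Equiv.Perm.exists_apply_eq_and_apply_eq {Ω : Type*} [DecidableEq Ω] {a b c d : Ω}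
    (hab : a ≠ b) (hcd : c ≠ d) : ∃ e : Perm Ω, e a = c ∧ e b = d := by
  refine ⟨swap (swap a c b) d * swap a c, ?_, by simp⟩
  rw [Perm.mul_apply, swap_apply_left, swap_apply_of_ne_of_ne _ hcd]
  intro h
  apply hab
  rwa [eq_comm, swap_apply_eq_iff, swap_apply_right, eq_comm] at h

/-- A property of self-maps of a finite type that is closed under composition and holds for
permutations and for one map collapsing a point `a` to another point `b` holds for every
self-map. -/
theorem Function.induction_collapse {Ω : Type*} [Finite Ω] [DecidableEq Ω] (P : (Ω → Ω) → Prop)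
    {a b : Ω} (hab : a ≠ b) (perm : ∀ e : Perm Ω, P e) (collapse : P (Function.update id a b))
    (comp : ∀ f g, P f → P g → P (g ∘ f)) (f : Ω → Ω) : P f := by
  have collapse' (c d : Ω) (hcd : c ≠ d) : P (Function.update id c d) := by
    obtain ⟨e, rfl, rfl⟩ := Perm.exists_apply_eq_and_apply_eq hab hcd
    have key : Function.update id (e a) (e b) = e ∘ Function.update id a b ∘ e.symm := by
      funext x
      by_cases hx : x = e a
      · simp [hx]
      · have hx' : e.symm x ≠ a := fun h => hx (by simp [← h])
        simp [Function.update_of_ne hx, Function.update_of_ne hx']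
    rw [key]
    exact comp _ _ (comp _ _ (perm e.symm) collapse) (perm e)
  induction hk : (Set.range f)ᶜ.ncard using Nat.strong_induction_on generalizing f with
  | _ k ih =>
  by_cases hf : Function.Injective f
  · exact perm (Equiv.ofBijective f (Finite.injective_iff_bijective.1 hf))
  · have hs : ¬ Function.Surjective f := fun h => hf (Finite.injective_iff_surjective.2 h)
    simp only [Function.Surjective, not_forall, not_exists] at hs
    obtain ⟨c, hc⟩ := hs
    simp only [Function.Injective, not_forall] at hf
    obtain ⟨x, y, hxy, hne⟩ := hf
    have hlt : (Set.range (Function.update f x c))ᶜ.ncard < k := by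
      rw [← hk]
      refine Set.ncard_lt_ncard ?_ (Set.toFinite _)
      rw [Set.ssubset_iff_of_subset]
      · exact ⟨c, by simpa using hc, by simpa using ⟨x, by simp⟩⟩
      · rw [Set.compl_subset_compl]
        rintro _ ⟨z, rfl⟩
        by_cases hz : z = x
        · exact ⟨y, by rw [Function.update_of_ne (Ne.symm hne), hz, hxy]⟩
        · exact ⟨z, Function.update_of_ne hz _ _⟩
    have key : f = Function.update id c (f y) ∘ Function.update f x c := by
      funext z
      by_cases hz : z = x
      · simp [hz, hxy]
      · simp [hz, Function.update_of_ne (hc z)]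
    rw [key]
    exact comp _ _ (ih _ hlt _ rfl) (collapse' _ _ (Ne.symm (hc y)))

theorem Fin.add_one_induction {m : ℕ} {P : Fin (m + 1) → Prop} (zero : P 0)
    (add_one : ∀ i, P i → P (i + 1)) (i : Fin (m + 1)) : P i := by
  induction i using Fin.induction with
  | zero => exact zero
  | succ i ih => simpa using add_one _ ih

theorem Submonoid.exists_mem_of_closure_eq_top {M : Type*} [Monoid M] {X : Set M}
    (hX : Submonoid.closure X = ⊤) (P : M → Prop) (h1 : ¬ P 1)
    (hmul : ∀ a b, P (a * b) → P a ∨ P b) {w : M} (hw : P w) : ∃ x ∈ X, P x := by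
  by_contra! h
  have hmem : w ∈ Submonoid.closure X := hX ▸ Submonoid.mem_top w
  induction hmem using Submonoid.closure_induction with
  | mem x hx => exact h x hx hw
  | one => exact h1 hw
  | mul a b _ _ iha ihb => exact (hmul a b hw).elim iha ihb

namespace PT

variable {Ω : Type}

theorem mul_apply (f g : PT Ω) (x : Ω) : (f * g) x = (f x).bind g := rfl

theorem mul_apply_of_eq_some {f : PT Ω} {x y : Ω} (h : f x = some y) (g : PT Ω) :
    (f * g) x = g y := by
  rw [mul_apply, h]
  rfl

theorem mul_apply_of_eq_none {f : PT Ω} {x : Ω} (h : f x = none) (g : PT Ω) :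
    (f * g) x = none := by
  rw [mul_apply, h]
  rfl

/-- Permutations as partial transformations; the inverse accounts for left-to-right
composition in `PT Ω`. -/
def ofPerm : Perm Ω →* PT Ω where
  toFun e x := some (e.symm x)
  map_one' := rfl
  map_mul' _ _ := rfl

theorem ofPerm_apply (e : Perm Ω) (x : Ω) : ofPerm e x = some (e.symm x) := rfl

/-- Total maps as partial transformations. -/
def ofFun (g : Ω → Ω) : PT Ω := fun x => some (g x)

theorem ofFun_apply (g : Ω → Ω) (x : Ω) : ofFun g x = some (g x) := rfl

variable [DecidableEq Ω]

/-- Replace the value of a partial transformation at one point. -/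
def update (f : PT Ω) (c : Ω) (o : Option Ω) : PT Ω := Function.update f c o

theorem update_self (f : PT Ω) (c : Ω) (o : Option Ω) : update f c o c = o :=
  Function.update_self (β := fun _ => Option Ω) c o f

theorem update_of_ne (f : PT Ω) {c x : Ω} (h : x ≠ c) (o : Option Ω) : update f c o x = f x :=
  Function.update_of_ne (β := fun _ => Option Ω) h o f

/-- The identity restricted to the complement of `c`. -/
def erase (c : Ω) : PT Ω := update 1 c none

theorem erase_self (c : Ω) : erase c c = none := update_self _ _ _

theorem erase_of_ne {c x : Ω} (h : x ≠ c) : erase c x = some x := update_of_ne _ h _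

/-- The partial transformation monoid of a finite set is generated by the permutations, a map
collapsing one point to another, and the identity restricted to the complement of a point. -/
theorem mem_of_perm_collapse_erase [Finite Ω] (M : Submonoid (PT Ω)) {a b : Ω}
    (hab : a ≠ b) (perm : ∀ e, ofPerm e ∈ M) (collapse : ofFun (Function.update id a b) ∈ M)
    (erase_mem : erase a ∈ M) (f : PT Ω) : f ∈ M := by
  have total (g : Ω → Ω) : ofFun g ∈ M :=
    Function.induction_collapse (fun g => ofFun g ∈ M) hab
      (fun e => perm e.symm) collapse (fun f g hf hg => mul_mem hf hg) g
  have erase_mem' (c : Ω) : erase c ∈ M := by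
    have key : erase c = ofPerm (swap a c) * erase a * ofPerm (swap a c) := by
      funext x
      by_cases hx : x = c
      · rw [hx, mul_assoc, mul_apply_of_eq_some (ofPerm_apply _ _), symm_swap, swap_apply_right,
          mul_apply_of_eq_none (erase_self a), erase_self]
      · have hx' : swap a c x ≠ a := by rwa [Ne, swap_apply_eq_iff, swap_apply_left]
        rw [mul_assoc, mul_apply_of_eq_some (ofPerm_apply _ _), symm_swap,
          mul_apply_of_eq_some (erase_of_ne hx'), ofPerm_apply, symm_swap, swap_apply_self,
          erase_of_ne hx]
    rw [key]
    exact mul_mem (mul_mem (perm _) erase_mem) (perm _)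
  induction hk : {x | f x = none}.ncard generalizing f with
  | zero =>
    rw [Set.ncard_eq_zero, Set.eq_empty_iff_forall_notMem] at hk
    have key : f = ofFun fun x => (f x).get (Option.isSome_iff_ne_none.2 (hk x)) := by
      funext x
      simp [ofFun_apply]
    rw [key]
    exact total _
  | succ k ih =>
    obtain ⟨c, hc⟩ : {x | f x = none}.Nonempty := by
      rw [← Set.ncard_pos]
      lia
    have hcard : {x | update f c (some c) x = none}.ncard = k := by
      have : {x | update f c (some c) x = none} = {x | f x = none} \ {c} := by
        ext x
        by_cases hx : x = c
        · simp [hx, update_self]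
        · simp [hx, update_of_ne f hx]
      rw [this, Set.ncard_sdiff_singleton_of_mem hc, hk, Nat.add_sub_cancel]
    have key : f = erase c * update f c (some c) := by
      funext x
      by_cases hx : x = c
      · rw [hx, mul_apply_of_eq_none (erase_self c)]
        exact hc
      · rw [mul_apply_of_eq_some (erase_of_ne hx), update_of_ne f hx]
    rw [key]
    exact mul_mem (erase_mem' c) (ih _ hcard)

end PT

namespace W

variable {n m : ℕ}

/-- The base monoid `PT_n ^ m` inside the wreath product. -/
def base : (Fin m → PT (Fin n)) →* W n m where
  toFun F := W.mk F id
  map_one' := rfl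
  map_mul' _ _ := rfl

/-- The copy of the symmetric group permuting the coordinates. -/
def top : Perm (Fin m) →* W n m where
  toFun σ := W.mk 1 σ.symm
  map_one' := rfl
  map_mul' _ _ := rfl

/-- The base group of the group of units of the wreath product. -/
def permBase : (Fin m → Perm (Fin n)) →* W n m := base.comp (PT.ofPerm.compLeft (Fin m))

theorem permBase_mulSingle (j : Fin m) (e : Perm (Fin n)) :
    permBase (Pi.mulSingle j e) = base (Pi.mulSingle j (PT.ofPerm e)) := by
  refine congrArg base (funext fun i => ?_)
  exact Pi.apply_mulSingle (fun _ => PT.ofPerm) (fun _ => map_one _) j e i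

theorem mk_eq_base_mul (F : Fin m → PT (Fin n)) (τ : Fin m → Fin m) :
    W.mk F τ = base F * W.mk 1 τ := by
  refine Prod.ext (funext fun j => ?_) rfl
  exact (mul_one (F j)).symm

theorem top_mul_base (σ : Perm (Fin m)) (F : Fin m → PT (Fin n)) :
    top σ * base F = base (F ∘ σ.symm) * top σ := by
  refine Prod.ext (funext fun j => ?_) rfl
  exact (one_mul _).trans (mul_one _).symm

theorem mulSingle_comp_symm {M : Type*} [One M] (σ : Perm (Fin m)) (j : Fin m) (f : M) :
    (Pi.mulSingle j f : Fin m → M) ∘ σ.symm = Pi.mulSingle (σ j) f := by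
  funext i
  by_cases h : i = σ j
  · simp [h]
  · have h' : σ.symm i ≠ j := fun h' => h (by simp [← h'])
    simp [h, h']

theorem top_mul_permBase (σ : Perm (Fin m)) (F : Fin m → Perm (Fin n)) :
    top σ * permBase F = permBase (F ∘ σ.symm) * top σ :=
  top_mul_base σ _

section Generation

variable {S : Submonoid (W n m)}

theorem permBase_comp_mem {σ : Perm (Fin m)} (hσ : top σ ∈ S) {F : Fin m → Perm (Fin n)}
    (hF : permBase F ∈ S) : permBase (F ∘ σ.symm) ∈ S := by
  have h : permBase (F ∘ σ.symm) = top σ * permBase F * top σ⁻¹ := by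
    rw [top_mul_permBase, mul_assoc, ← map_mul, mul_inv_cancel, map_one, mul_one]
  rw [h]
  exact mul_mem (mul_mem hσ hF) (Submonoid.inv_mem_of_finite (S.comap top) hσ)

/-- A submonoid containing all coordinate permutations and the base elements supported at one
coordinate contains the whole base monoid. -/
theorem base_mem (hS : ∀ σ, top σ ∈ S) (j : Fin m) (h : ∀ f, base (Pi.mulSingle j f) ∈ S)
    (F : Fin m → PT (Fin n)) : base F ∈ S := by
  refine Submonoid.pi_mem_of_mulSingle_mem (H := S.comap base) F fun i => ?_
  have key : base (Pi.mulSingle i (F i)) =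
      top (swap j i) * base (Pi.mulSingle j (F i)) * top (swap j i)⁻¹ := by
    rw [top_mul_base, mulSingle_comp_symm, swap_apply_left, mul_assoc, ← map_mul, mul_inv_cancel,
      map_one, mul_one]
  rw [Submonoid.mem_comap, key]
  exact mul_mem (mul_mem (hS _) (h _)) (hS _)

/-- A submonoid containing the coordinate permutations, a transposition at one coordinate and a
diagonal permutation generating the symmetric group together with this transposition contains all
base permutations. -/
theorem permBase_mem (hS : ∀ σ, top σ ∈ S) {a b : Fin n} (hab : a ≠ b) {q : Perm (Fin n)}
    (hq : Subgroup.closure {q, swap a b} = ⊤) (j : Fin m)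
    (hp : permBase (Pi.mulSingle j (swap a b)) ∈ S) (hqS : permBase (fun _ => q) ∈ S)
    (F : Fin m → Perm (Fin n)) : permBase F ∈ S := by
  have single (e : Perm (Fin n)) (he : permBase (Pi.mulSingle j e) ∈ S) (i : Fin m) :
      permBase (Pi.mulSingle i e) ∈ S := by
    have := permBase_comp_mem (hS (swap j i)) he
    rwa [mulSingle_comp_symm, swap_apply_left] at this
  have diag (e : Perm (Fin n)) : permBase (fun _ => e) ∈ S := by
    refine Submonoid.mem_of_subgroup_closure_eq_top
      (S.comap (permBase.comp (Pi.constMonoidHom (Fin m) (Perm (Fin n))))) hq ?_ e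
    rintro _ (rfl | rfl)
    · exact hqS
    · exact Submonoid.pi_mem_of_mulSingle_mem (H := S.comap permBase) _ (single _ hp)
  have conj (e : Perm (Fin n)) : permBase (Pi.mulSingle j (e * swap a b * e⁻¹)) ∈ S := by
    have key : (Pi.mulSingle j (e * swap a b * e⁻¹) : Fin m → Perm (Fin n)) =
        (fun _ => e) * Pi.mulSingle j (swap a b) * fun _ => e⁻¹ := by
      funext i
      by_cases h : i = j
      · subst h
        simp
      · simp [h]
    rw [key, map_mul, map_mul]
    exact mul_mem (mul_mem (diag _) hp) (diag _)
  refine Submonoid.pi_mem_of_mulSingle_mem (H := S.comap permBase) F fun i => single _ ?_ i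
  refine Submonoid.mem_of_subgroup_closure_eq_top
      (S.comap (permBase.comp (MonoidHom.mulSingle _ j))) Perm.closure_isSwap ?_ (F i)
  rintro _ ⟨x, y, hxy, rfl⟩
  obtain ⟨e, he⟩ := isConj_iff.1 (Perm.isConj_swap hab hxy)
  exact he ▸ conj e

/-- A submonoid containing all units and three maps of defect one is everything. -/
theorem mem_of_units (hS : ∀ σ, top σ ∈ S) (hB : ∀ F, permBase F ∈ S) {a b : Fin n} (hab : a ≠ b)
    {i j : Fin m} (hij : i ≠ j)
    (hα : base (Pi.mulSingle i (PT.ofFun (Function.update id a b))) ∈ S)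
    (hβ : base (Pi.mulSingle i (PT.erase a)) ∈ S)
    (hγ : W.mk 1 (Function.update id i j) ∈ S) (w : W n m) : w ∈ S := by
  have hbase : ∀ F, base F ∈ S := base_mem hS i fun f =>
    PT.mem_of_perm_collapse_erase
      (S.comap (base.comp (MonoidHom.mulSingle (fun _ => PT (Fin n)) i))) hab
      (fun e => by simpa [permBase_mulSingle] using hB (Pi.mulSingle i e)) hα hβ f
  have htop (τ : Fin m → Fin m) : W.mk 1 τ ∈ S :=
    Function.induction_collapse (fun τ => (W.mk 1 τ : W n m) ∈ S) hij
      (fun e => hS e.symm) hγ (fun f g hf hg => mul_mem hf hg) τ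
  have : w = base w.1 * W.mk 1 w.2 := mk_eq_base_mul w.1 w.2
  rw [this]
  exact mul_mem (hbase _) (htop _)

end Generation

theorem permBase_mulSingle_mem_of_odd (hm : Odd (m + 2)) {p : Perm (Fin n)} (hp2 : p ^ 2 = 1)
    {S : Submonoid (W n (m + 2))} (hp : permBase (fun _ => p) ∈ S)
    (hp₁ : permBase (Pi.mulSingle 0 p * Pi.mulSingle 1 p) ∈ S)
    (hc : top (finRotate (m + 2)) ∈ S) : permBase (Pi.mulSingle 0 p) ∈ S := by
  -- `N` records the exponent vectors of the powers of `p` lying in `S`.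
  let N : AddSubmonoid (Fin (m + 2) → ℕ) :=
    { carrier := {v | permBase (fun i => p ^ v i) ∈ S}
      zero_mem' := by
        change permBase 1 ∈ S
        rw [map_one]
        exact one_mem S
      add_mem' := fun {v w} hv hw => by
        have : (fun i => p ^ (v + w) i) = (fun i => p ^ v i) * fun i => p ^ w i :=
          funext fun i => pow_add p _ _
        change permBase _ ∈ S
        rw [this, map_mul]
        exact mul_mem hv hw }
  have hN {v : Fin (m + 2) → ℕ} : v ∈ N ↔ permBase (fun i => p ^ v i) ∈ S := Iff.rfl
  have hN_congr {v w : Fin (m + 2) → ℕ} (h : ∀ i, v i ≡ w i [MOD 2]) (hv : v ∈ N) : w ∈ N := by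
    rw [hN] at hv ⊢
    convert hv using 3 with i
    exact (pow_eq_pow_of_modEq (h i) hp2).symm
  have single (i : Fin (m + 2)) :
      (fun l => p ^ (Pi.single i 1 : Fin (m + 2) → ℕ) l) = Pi.mulSingle i p := by
    funext l
    by_cases h : l = i
    · subst h
      simp
    · simp [h]
  have adj (i : Fin (m + 2)) : permBase (Pi.mulSingle i p * Pi.mulSingle (i + 1) p) ∈ S := by
    induction i using Fin.add_one_induction with
    | zero => simpa using hp₁
    | add_one i ih =>
      have h := permBase_comp_mem hc ih
      have hcomp : (Pi.mulSingle i p * Pi.mulSingle (i + 1) p : Fin (m + 2) → Perm (Fin n)) ∘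
          (finRotate (m + 2)).symm =
          (Pi.mulSingle i p ∘ (finRotate (m + 2)).symm) *
            (Pi.mulSingle (i + 1) p ∘ (finRotate (m + 2)).symm) := rfl
      rwa [hcomp, mulSingle_comp_symm, mulSingle_comp_symm, finRotate_apply, finRotate_apply] at h
  have hN_adj (i : Fin (m + 2)) : Pi.single i 1 + Pi.single (i + 1) 1 ∈ N := by
    rw [hN]
    convert adj i using 2
    rw [← single, ← single]
    exact funext fun _ => pow_add _ _ _
  have hN_zero (k : Fin (m + 2)) : Pi.single 0 1 + Pi.single k 1 ∈ N := by
    induction k using Fin.add_one_induction with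
    | zero =>
      refine hN_congr (fun i => ?_) (zero_mem N)
      simp only [Pi.add_apply, Pi.zero_apply, Nat.ModEq]
      lia
    | add_one k ih =>
      refine hN_congr (fun i => ?_) (add_mem ih (hN_adj k))
      simp only [Pi.add_apply, Nat.ModEq]
      lia
  have parity (s : ℕ) : ((m + 2) * s + 1 + 1) % 2 = s % 2 := by
    obtain ⟨r, hr⟩ := hm
    rw [hr, add_mul, mul_assoc]
    lia
  have hsum : ∑ i : Fin (m + 2), (Pi.single 0 1 + Pi.single i 1) + (fun _ => 1) ∈ N := by
    refine add_mem (sum_mem fun i _ => hN_zero i) ?_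
    simpa [hN] using hp
  have := hN_congr (w := Pi.single 0 1) (fun i => ?_) hsum
  · rwa [hN, single] at this
  · rw [Finset.sum_add_distrib, Finset.univ_sum_single (fun _ : Fin (m + 2) => (1 : ℕ))]
    simp only [Finset.sum_const, Finset.card_univ, Fintype.card_fin, Pi.add_apply, Pi.smul_apply,
      smul_eq_mul, Nat.ModEq]
    exact parity _

/-- The unit group of `W` is generated by two elements when the number of coordinates is even. -/
theorem units_mem_of_even (hm : Even (m + 2)) {q : Perm (Fin (n + 2))} {k : ℕ} (hk : Odd k)
    (hqk : q ^ k = 1) (hq : Subgroup.closure {q, swap 0 1} = ⊤) {S : Submonoid (W (n + 2) (m + 2))}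
    (hx : top (swap 0 1) * permBase (fun _ => q) ∈ S)
    (hy : permBase (Pi.mulSingle 0 (swap 0 1)) * top (rotateSucc m) ∈ S) :
    (∀ σ, top σ ∈ S) ∧ ∀ F, permBase F ∈ S := by
  obtain ⟨ht, hqS⟩ := S.mem_and_mem_of_coprime (a := 2) (b := k)
    (x := top (swap 0 1)) (y := permBase fun _ => q) (top_mul_permBase _ _)
    (by rw [← map_pow, pow_two, swap_mul_self, map_one])
    (by rw [← map_pow, ← map_one permBase]; exact congrArg permBase (funext fun _ => hqk))
    hk.coprime_two_left hx
  obtain ⟨hp, hc⟩ := S.mem_and_mem_of_coprime (a := 2) (b := m + 1)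
    (x := permBase (Pi.mulSingle 0 (swap 0 1))) (y := top (rotateSucc m))
    (Commute.symm (by
      rw [commute_iff_eq, top_mul_permBase, mulSingle_comp_symm, rotateSucc_zero]))
    (by rw [← map_pow, ← Pi.mulSingle_pow, pow_two, swap_mul_self, Pi.mulSingle_one, map_one])
    (by rw [← map_pow, rotateSucc_pow_self, map_one])
    (Odd.coprime_two_left (by grind)) hy
  have htop (σ : Perm (Fin (m + 2))) : top σ ∈ S := by
    refine Submonoid.mem_of_subgroup_closure_eq_top (S.comap top) (closure_rotateSucc_swap m) ?_ σ
    rintro _ (rfl | rfl)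
    exacts [hc, ht]
  exact ⟨htop, permBase_mem htop (by simp) hq 0 hp hqS⟩

/-- The unit group of `W` is generated by two elements when the number of coordinates is odd. -/
theorem units_mem_of_odd (hm : Odd (m + 2)) {j : Fin (m + 2)} (hj₀ : j ≠ 0) (hj₁ : j ≠ 1)
    {q : Perm (Fin (n + 2))} {k : ℕ} (hk : Odd k)
    (hqk : q ^ k = 1) (hq : Subgroup.closure {q, swap 0 1} = ⊤) {S : Submonoid (W (n + 2) (m + 2))}
    (hx : permBase (Pi.mulSingle 0 (swap 0 1)) * top (swap 0 1) * permBase (Pi.mulSingle j q) ∈ S)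
    (hy : permBase (fun _ => swap 0 1) * top (finRotate (m + 2)) ∈ S) :
    (∀ σ, top σ ∈ S) ∧ ∀ F, permBase F ∈ S := by
  set p : Perm (Fin (n + 2)) := swap 0 1
  have hp2 : p ^ 2 = 1 := by rw [pow_two, swap_mul_self]
  have hA : (permBase (Pi.mulSingle 0 p) * top (swap 0 1) : W (n + 2) (m + 2)) ^ 2 =
      permBase (Pi.mulSingle 0 p * Pi.mulSingle 1 p) := by
    rw [pow_two, mul_assoc, ← mul_assoc (top _), top_mul_permBase, mulSingle_comp_symm,
      swap_apply_left, mul_assoc, ← map_mul top, swap_mul_self, map_one, mul_one, map_mul]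
  have hcomm : Commute (Pi.mulSingle 0 p : Fin (m + 2) → Perm (Fin (n + 2))) (Pi.mulSingle 1 p) :=
    Pi.mulSingle_commute (f := fun _ : Fin (m + 2) => Perm (Fin (n + 2))) (i := 0) (j := 1)
      (by simp) p p
  obtain ⟨hAS, hqS⟩ := S.mem_and_mem_of_coprime (a := 4) (b := k)
    (x := permBase (Pi.mulSingle 0 p) * top (swap 0 1)) (y := permBase (Pi.mulSingle j q))
    (Commute.mul_left
      ((Pi.mulSingle_commute (f := fun _ : Fin (m + 2) => Perm (Fin (n + 2)))
        hj₀.symm p q).map permBase)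
      (by rw [commute_iff_eq, top_mul_permBase, mulSingle_comp_symm,
            swap_apply_of_ne_of_ne hj₀ hj₁]))
    (by rw [show 4 = 2 * 2 from rfl, pow_mul, hA, ← map_pow, hcomm.mul_pow, ← Pi.mulSingle_pow,
          ← Pi.mulSingle_pow, hp2, Pi.mulSingle_one, Pi.mulSingle_one, one_mul, map_one])
    (by rw [← map_pow, ← Pi.mulSingle_pow, hqk, Pi.mulSingle_one, map_one])
    (Nat.Coprime.pow_left 2 hk.coprime_two_left) hx
  obtain ⟨hpS, hc⟩ := S.mem_and_mem_of_coprime (a := 2) (b := m + 2)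
    (x := permBase (fun _ => p)) (y := top (finRotate (m + 2)))
    (Commute.symm (top_mul_permBase _ _))
    (by rw [← map_pow, ← map_one permBase]; exact congrArg permBase (funext fun _ => hp2))
    (by rw [← map_pow, finRotate_pow_self, map_one])
    hm.coprime_two_left hy
  have hp : permBase (Pi.mulSingle 0 p) ∈ S :=
    permBase_mulSingle_mem_of_odd hm hp2 hpS (hA ▸ pow_mem hAS 2) hc
  have ht : top (swap 0 1) ∈ S := by
    have key : top (swap 0 1) = permBase (Pi.mulSingle 0 p) *
        (permBase (Pi.mulSingle 0 p) * top (swap 0 1) : W (n + 2) (m + 2)) := by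
      rw [← mul_assoc, ← map_mul, ← Pi.mulSingle_mul, swap_mul_self, Pi.mulSingle_one, map_one,
        one_mul]
    rw [key]
    exact mul_mem hp hAS
  have htop (σ : Perm (Fin (m + 2))) : top σ ∈ S := by
    refine Submonoid.mem_of_subgroup_closure_eq_top (S.comap top) (closure_finRotate_swap m) ?_ σ
    rintro _ (rfl | rfl)
    exacts [hc, ht]
  refine ⟨htop, permBase_mem htop (by simp) hq 0 hp ?_⟩
  refine Submonoid.pi_mem_of_mulSingle_mem (H := S.comap permBase) _ fun i => ?_
  have := permBase_comp_mem (htop (swap j i)) hqS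
  rwa [mulSingle_comp_symm, swap_apply_left] at this

theorem mul_fst (a b : W n m) (j : Fin m) : (a * b).1 j = a.1 j * b.1 (a.2 j) := rfl

theorem base_mul_top_fst (F : Fin m → PT (Fin n)) (σ : Perm (Fin m)) : (base F * top σ).1 = F :=
  funext fun j => mul_one (F j)

/-- All components are total maps. -/
def Total (w : W n m) : Prop := ∀ j i, w.1 j i ≠ none

/-- All components are injective as maps into `Option`. -/
def FiberInjective (w : W n m) : Prop := ∀ j, Function.Injective (w.1 j)

/-- The units of the wreath product. -/
def IsPerm (w : W n m) : Prop := w.Total ∧ w.FiberInjective ∧ Function.Injective w.2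

variable {a b : W n m}

theorem Total.of_mul (h : (a * b).Total) : a.Total := fun j i hi =>
  h j i (PT.mul_apply_of_eq_none hi _)

theorem Total.mul (ha : a.Total) (hb : b.Total) : (a * b).Total := fun j i => by
  obtain ⟨x, hx⟩ := Option.ne_none_iff_exists'.1 (ha j i)
  rw [mul_fst, PT.mul_apply_of_eq_some hx]
  exact hb _ _

theorem FiberInjective.of_mul (h : (a * b).FiberInjective) : a.FiberInjective :=
  fun j x y hxy => h j (by rw [mul_fst, PT.mul_apply, PT.mul_apply, hxy])

theorem FiberInjective.mul (ha : a.Total) (ha' : a.FiberInjective) (hb : b.FiberInjective) :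
    (a * b).FiberInjective := fun j x y hxy => by
  obtain ⟨x', hx⟩ := Option.ne_none_iff_exists'.1 (ha j x)
  obtain ⟨y', hy⟩ := Option.ne_none_iff_exists'.1 (ha j y)
  rw [mul_fst, PT.mul_apply_of_eq_some hx, PT.mul_apply_of_eq_some hy] at hxy
  exact ha' j (by rw [hx, hy, hb _ hxy])

theorem IsPerm.exists_eq_some (ha : a.IsPerm) (j : Fin m) (y : Fin n) :
    ∃ x, a.1 j x = some y := by
  choose g hg using fun x => Option.ne_none_iff_exists'.1 (ha.1 j x)
  have hinj : Function.Injective g := fun x x' h => ha.2.1 j (by rw [hg, hg, h])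
  obtain ⟨x, rfl⟩ := Finite.surjective_of_injective hinj y
  exact ⟨x, hg x⟩

theorem IsPerm.surjective_snd (ha : a.IsPerm) : Function.Surjective a.2 :=
  Finite.surjective_of_injective ha.2.2

theorem IsPerm.total_right (ha : a.IsPerm) (h : (a * b).Total) : b.Total := fun j y => by
  obtain ⟨j, rfl⟩ := ha.surjective_snd j
  obtain ⟨x, hx⟩ := ha.exists_eq_some j y
  have := h j x
  rwa [mul_fst, PT.mul_apply_of_eq_some hx] at this

theorem IsPerm.fiberInjective_right (ha : a.IsPerm) (h : (a * b).FiberInjective) :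
    b.FiberInjective := fun j y z hyz => by
  obtain ⟨j, rfl⟩ := ha.surjective_snd j
  obtain ⟨x, hx⟩ := ha.exists_eq_some j y
  obtain ⟨x', hx'⟩ := ha.exists_eq_some j z
  have : x = x' := h j (by
    rw [mul_fst, PT.mul_apply_of_eq_some hx, PT.mul_apply_of_eq_some hx', hyz])
  rw [this, hx'] at hx
  exact (Option.some.inj hx).symm

theorem injective_snd_of_mul (h : Function.Injective (a * b).2) :
    Function.Injective a.2 ∧ Function.Injective b.2 := by
  have ha : Function.Injective a.2 := Function.Injective.of_comp (f := b.2) h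
  exact ⟨ha, Function.Injective.of_comp_right (f := b.2) h (Finite.surjective_of_injective ha)⟩

theorem IsPerm.of_mul (h : (a * b).IsPerm) : a.IsPerm ∧ b.IsPerm := by
  obtain ⟨h₁, h₂, h₃⟩ := h
  have ha : a.IsPerm := ⟨h₁.of_mul, h₂.of_mul, (injective_snd_of_mul h₃).1⟩
  exact ⟨ha, ha.total_right h₁, ha.fiberInjective_right h₂, (injective_snd_of_mul h₃).2⟩

theorem isPerm_one : (1 : W n m).IsPerm :=
  ⟨fun _ _ h => Option.some_ne_none _ h, fun _ _ _ h => Option.some.inj h, fun _ _ h => h⟩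

theorem isPerm_permBase (F : Fin m → Perm (Fin n)) : (permBase F).IsPerm :=
  ⟨fun _ _ h => Option.some_ne_none _ h, fun _ _ _ h => (Equiv.injective _) (Option.some.inj h),
    fun _ _ h => h⟩

theorem isPerm_top (σ : Perm (Fin m)) : (top σ : W n m).IsPerm :=
  ⟨fun _ _ h => Option.some_ne_none _ h, fun _ _ _ h => Option.some.inj h, Equiv.injective _⟩

section Generators

variable {X : Set (W (n + 2) (m + 2))}

theorem exists_mem_not_total (hX : Submonoid.closure X = ⊤) :
    ∃ x ∈ X, ¬ x.Total ∧ Function.Injective x.2 := by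
  refine Submonoid.exists_mem_of_closure_eq_top hX _ (fun h => h.1 isPerm_one.1)
    (fun a b h => ?_) (w := W.mk (fun _ => PT.empty _) id)
    ⟨fun h => h 0 0 rfl, fun _ _ h => h⟩
  obtain ⟨ha, hb⟩ := injective_snd_of_mul h.2
  by_contra! hab
  exact h.1 (Total.mul (not_not.1 fun h' => hab.1 h' ha) (not_not.1 fun h' => hab.2 h' hb))

theorem exists_mem_not_fiberInjective (hX : Submonoid.closure X = ⊤) :
    ∃ x ∈ X, x.Total ∧ Function.Injective x.2 ∧ ¬ x.FiberInjective := by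
  refine Submonoid.exists_mem_of_closure_eq_top hX _ (fun h => h.2.2 isPerm_one.2.1)
    (fun a b h => ?_) (w := W.mk (fun _ => PT.ofFun fun _ => 0) id)
    ⟨fun _ _ h => Option.some_ne_none _ h, fun _ _ h => h,
      fun h => zero_ne_one (α := Fin (n + 2)) (h 0 rfl)⟩
  obtain ⟨h₁, h₂, h₃⟩ := h
  obtain ⟨ha, hb⟩ := injective_snd_of_mul h₂
  by_cases hf : a.FiberInjective
  · exact Or.inr ⟨IsPerm.total_right ⟨h₁.of_mul, hf, ha⟩ h₁, hb,
      fun h => h₃ (FiberInjective.mul h₁.of_mul hf h)⟩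
  · exact Or.inl ⟨h₁.of_mul, ha, hf⟩

theorem exists_mem_not_injective_snd (hX : Submonoid.closure X = ⊤) :
    ∃ x ∈ X, x.Total ∧ x.FiberInjective ∧ ¬ Function.Injective x.2 := by
  refine Submonoid.exists_mem_of_closure_eq_top hX _ (fun h => h.2.2 isPerm_one.2.2)
    (fun a b h => ?_) (w := W.mk 1 fun _ => 0)
    ⟨isPerm_one.1, isPerm_one.2.1,
      fun h => zero_ne_one (α := Fin (m + 2)) (h rfl)⟩
  obtain ⟨h₁, h₂, h₃⟩ := h
  by_cases ha : Function.Injective a.2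
  · have hp : a.IsPerm := ⟨h₁.of_mul, h₂.of_mul, ha⟩
    exact Or.inr ⟨hp.total_right h₁, hp.fiberInjective_right h₂, fun h => h₃ (h.comp ha)⟩
  · exact Or.inl ⟨h₁.of_mul, h₂.of_mul, ha⟩

theorem exists_mem_isPerm_pair (hX : Submonoid.closure X = ⊤) :
    ∃ x ∈ X, ∃ y ∈ X, x.IsPerm ∧ y.IsPerm ∧ x ≠ y := by
  have hmem (w : W (n + 2) (m + 2)) (hw : w.IsPerm) :
      w ∈ Submonoid.closure {x ∈ X | x.IsPerm} := by
    have h : w ∈ Submonoid.closure X := hX ▸ Submonoid.mem_top w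
    induction h using Submonoid.closure_induction with
    | mem x hx => exact Submonoid.subset_closure ⟨hx, hw⟩
    | one => exact one_mem _
    | mul a b _ _ iha ihb => exact mul_mem (iha hw.of_mul.1) (ihb hw.of_mul.2)
  by_contra! hsub
  obtain ⟨g, hg⟩ : ∃ g, {x ∈ X | x.IsPerm} ⊆ {g} := by
    rcases Set.eq_empty_or_nonempty {x ∈ X | x.IsPerm} with h | ⟨g, hg⟩
    · exact ⟨1, h ▸ Set.empty_subset _⟩
    · exact ⟨g, fun x hx => hsub x hx.1 g hg.1 hx.2 hg.2⟩
  have hpow (w : W (n + 2) (m + 2)) (hw : w.IsPerm) : ∃ k : ℕ, g ^ k = w :=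
    Submonoid.mem_closure_singleton.1 (Submonoid.closure_mono hg (hmem w hw))
  obtain ⟨k, hk⟩ := hpow _ (isPerm_permBase (Pi.mulSingle 0 (swap 0 1)))
  obtain ⟨l, hl⟩ := hpow _ (isPerm_top (swap 0 1))
  have hcomm := pow_mul_comm g l k
  rw [hk, hl, top_mul_permBase, mulSingle_comp_symm, swap_apply_left] at hcomm
  have h := congrFun (congrFun (congrArg Prod.fst hcomm) 0) 0
  rw [permBase_mulSingle, permBase_mulSingle, base_mul_top_fst, base_mul_top_fst,
    Pi.mulSingle_eq_same, Pi.mulSingle_eq_of_ne (by simp), PT.ofPerm_apply,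
    symm_swap, swap_apply_left] at h
  exact zero_ne_one (Option.some.inj h)

end Generators

theorem five_le_card {X : Finset (W (n + 2) (m + 2))}
    (hX : Submonoid.closure (X : Set (W (n + 2) (m + 2))) = ⊤) : 5 ≤ X.card := by
  classical
  obtain ⟨u, hu, v, hv, hu', hv', huv⟩ := exists_mem_isPerm_pair hX
  obtain ⟨x, hx, hx₁, hx₂⟩ := exists_mem_not_total hX
  obtain ⟨y, hy, hy₁, hy₂, hy₃⟩ := exists_mem_not_fiberInjective hX
  obtain ⟨z, hz, hz₁, hz₂, hz₃⟩ := exists_mem_not_injective_snd hX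
  have hsub : {u, v, x, y, z} ⊆ X := by
    simp only [Finset.insert_subset_iff, Finset.singleton_subset_iff]
    exact ⟨hu, hv, hx, hy, hz⟩
  have hcard : ({u, v, x, y, z} : Finset (W (n + 2) (m + 2))).card = 5 := by
    unfold IsPerm at hu' hv'
    have h₁ : u ∉ ({v, x, y, z} : Finset (W (n + 2) (m + 2))) := by
      simp only [Finset.mem_insert, Finset.mem_singleton]
      rintro (rfl | rfl | rfl | rfl) <;> tauto
    have h₂ : v ∉ ({x, y, z} : Finset (W (n + 2) (m + 2))) := by
      simp only [Finset.mem_insert, Finset.mem_singleton]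
      rintro (rfl | rfl | rfl) <;> tauto
    have h₃ : x ∉ ({y, z} : Finset (W (n + 2) (m + 2))) := by
      simp only [Finset.mem_insert, Finset.mem_singleton]
      rintro (rfl | rfl) <;> tauto
    have h₄ : y ≠ z := by
      rintro rfl
      tauto
    rw [Finset.card_insert_of_notMem h₁, Finset.card_insert_of_notMem h₂,
      Finset.card_insert_of_notMem h₃, Finset.card_pair h₄]
  exact hcard ▸ Finset.card_le_card hsub

theorem exists_units_generators (n m : ℕ) : ∃ x y : W (n + 2) (m + 2),
    ∀ S : Submonoid (W (n + 2) (m + 2)), x ∈ S → y ∈ S →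
      (∀ σ, top σ ∈ S) ∧ ∀ F, permBase F ∈ S := by
  obtain ⟨q, k, hk, hqk, hq⟩ := exists_odd_pow_eq_one_closure_swap n
  rcases Nat.even_or_odd (m + 2) with hm | hm
  · exact ⟨_, _, fun S hx hy => units_mem_of_even hm hk hqk hq hx hy⟩
  · obtain ⟨j, hj₀, hj₁⟩ : ∃ j : Fin (m + 2), j ≠ 0 ∧ j ≠ 1 := by
      have hlt : 2 < m + 2 := by grind
      refine ⟨⟨2, hlt⟩, ?_, ?_⟩ <;> simp [Fin.ext_iff]
    exact ⟨_, _, fun S hx hy => units_mem_of_odd hm hj₀ hj₁ hk hqk hq hx hy⟩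

theorem exists_generators_card_le (n m : ℕ) : ∃ X : Finset (W (n + 2) (m + 2)),
    X.card ≤ 5 ∧ Submonoid.closure (X : Set (W (n + 2) (m + 2))) = ⊤ := by
  classical
  obtain ⟨x, y, hxy⟩ := exists_units_generators n m
  let X : Finset (W (n + 2) (m + 2)) :=
    {x, y, base (Pi.mulSingle 0 (PT.ofFun (Function.update id 0 1))),
      base (Pi.mulSingle 0 (PT.erase 0)), W.mk 1 (Function.update id 0 1)}
  refine ⟨X, Finset.card_le_five, eq_top_iff.2 fun w _ => ?_⟩
  obtain ⟨hS, hB⟩ := hxy (Submonoid.closure X) (Submonoid.subset_closure (by simp [X]))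
    (Submonoid.subset_closure (by simp [X]))
  exact mem_of_units hS hB (zero_ne_one (α := Fin (n + 2))) (zero_ne_one (α := Fin (m + 2)))
    (Submonoid.subset_closure (by simp [X])) (Submonoid.subset_closure (by simp [X]))
    (Submonoid.subset_closure (by simp [X])) w

end W

/-- The rank of the wreath product `PT_n ≀ T_m` is 5. -/
theorem stmt8 (n m : ℕ) (hn : 2 ≤ n) (hm : 2 ≤ m) :
    (∃ X : Finset (W n m), X.card = 5 ∧ Submonoid.closure (X : Set (W n m)) = ⊤) ∧
      ∀ X : Finset (W n m), X.card ≤ 4 → Submonoid.closure (X : Set (W n m)) ≠ ⊤ := by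
  obtain ⟨n, rfl⟩ := Nat.exists_eq_add_of_le' hn
  obtain ⟨m, rfl⟩ := Nat.exists_eq_add_of_le' hm
  refine ⟨?_, fun X hX h => absurd (W.five_le_card h) (by lia)⟩
  obtain ⟨X, hX, h⟩ := W.exists_generators_card_le n m
  exact ⟨X, le_antisymm hX (W.five_le_card h), h⟩
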